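/- For any prime p ≥ 5 and positive integer k, the Gaussian binomial coefficient C(kp, p)_q satisfies C(kp, p)_q ≡ [k]_{q^{p^2}} − C(k,2)·((p^2−1)/12)·(q^p − 1)^2 modulo [p]_q^3 in ℤ[q]. -/

import Mathlib

open Polynomial Finset

noncomputable def qInt (n : ℕ) : Polynomial ℤ := ∑ i ∈ Finset.range n, X ^ i

noncomputable def qBinom : ℕ → ℕ → Polynomial ℤ
  | _, 0 => 1
  | 0, _ + 1 => 0
  | n + 1, k + 1 => qBinom n k + X ^ (k + 1) * qBinom n (k + 1)

theorem qBinom_eq_zero_of_lt {n k : ℕ} (h : n < k) : qBinom n k = 0 := by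
  induction n generalizing k with
  | zero => obtain ⟨k, rfl⟩ := Nat.exists_eq_succ_of_ne_zero h.ne'; rw [qBinom]
  | succ n ih =>
    obtain ⟨k, rfl⟩ := Nat.exists_eq_succ_of_ne_zero (Nat.ne_zero_of_lt h)
    rw [qBinom, ih (by omega), ih (by omega)]
    simp

theorem qBinom_zero_right (n : ℕ) : qBinom n 0 = 1 := by
  cases n <;> rw [qBinom]

theorem qBinom_mul_prod (m r : ℕ) :
    qBinom (m + r) r * ∏ j ∈ range r, (1 - X ^ (j + 1) : ℤ[X]) =
      ∏ j ∈ range r, (1 - X ^ (m + j + 1)) := by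
  induction r generalizing m with
  | zero => simp [qBinom_zero_right]
  | succ r ihr =>
    induction m with
    | zero =>
      have h := ihr 0
      rw [zero_add] at h ⊢
      rw [qBinom, qBinom_eq_zero_of_lt r.lt_succ_self, prod_range_succ, prod_range_succ,
        zero_add, mul_zero, add_zero, ← mul_assoc, h]
    | succ m ihm =>
      have h := ihr (m + 1)
      have e : m + 1 + r = m + (r + 1) := by ring
      rw [e] at h
      rw [prod_range_succ' (fun j ↦ (1 - X ^ (m + j + 1) : ℤ[X]))] at ihm
      have e' : ∏ j ∈ range r, (1 - X ^ (m + (j + 1) + 1) : ℤ[X]) =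
          ∏ j ∈ range r, (1 - X ^ (m + 1 + j + 1)) :=
        prod_congr rfl fun j _ ↦ by ring
      rw [e'] at ihm
      rw [show m + 1 + (r + 1) = (m + (r + 1)) + 1 by ring, qBinom]
      rw [prod_range_succ] at ihm ⊢
      rw [prod_range_succ]
      linear_combination X ^ (r + 1) * ihm + (1 - X ^ (r + 1)) * h

theorem qBinom_mul_mul_prod (m n : ℕ) :
    qBinom (m * (n + 1) + (n + 1)) (n + 1) * ∏ j ∈ range n, (1 - X ^ (j + 1) : ℤ[X]) =
      (∑ i ∈ range (m + 1), (X ^ (n + 1)) ^ i) *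
        ∏ j ∈ range n, (1 - X ^ (m * (n + 1) + j + 1)) := by
  have h := qBinom_mul_prod (m * (n + 1)) (n + 1)
  rw [prod_range_succ, prod_range_succ] at h
  have hg := geom_sum_mul (X ^ (n + 1) : ℤ[X]) (m + 1)
  have hne : (X ^ (n + 1) - 1 : ℤ[X]) ≠ 0 := (monic_X_pow_sub_C (1 : ℤ) n.succ_ne_zero).ne_zero
  refine mul_right_cancel₀ hne ?_
  linear_combination -h - (∏ j ∈ range n, (1 - X ^ (m * (n + 1) + j + 1))) * hg

section CommRing

variable {R : Type*} [CommRing R]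

theorem pow_three_dvd_two_mul_prod_one_add_mul_sub {ι : Type*} (s : Finset ι) (z : ι → R) (y : R) :
    y ^ 3 ∣ 2 * ∏ i ∈ s, (1 + y * z i) -
      (2 + 2 * y * ∑ i ∈ s, z i + y ^ 2 * ((∑ i ∈ s, z i) ^ 2 - ∑ i ∈ s, z i ^ 2)) := by
  classical
  induction s using Finset.induction_on with
  | empty => simp
  | insert a s ha ih =>
    obtain ⟨c, hc⟩ := ih
    rw [prod_insert ha, sum_insert ha, sum_insert ha]
    refine ⟨c * (1 + y * z a) + z a * ((∑ i ∈ s, z i) ^ 2 - ∑ i ∈ s, z i ^ 2), ?_⟩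
    linear_combination (1 + y * z a) * hc

theorem pow_three_dvd_one_add_pow_sub (t : R) (n : ℕ) :
    t ^ 3 ∣ (1 + t) ^ n - (1 + n * t + n.choose 2 * t ^ 2) := by
  induction n with
  | zero => simp
  | succ n ih =>
    obtain ⟨c, hc⟩ := ih
    refine ⟨c * (1 + t) + n.choose 2, ?_⟩
    rw [Nat.choose_succ_succ' n 1, Nat.choose_one_right]
    push_cast
    linear_combination (1 + t) * hc

theorem pow_three_dvd_geom_sum_one_add_sub (t : R) (n : ℕ) :
    t ^ 3 ∣ ∑ i ∈ range n, (1 + t) ^ i - (n + n.choose 2 * t + n.choose 3 * t ^ 2) := by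
  induction n with
  | zero => simp
  | succ n ih =>
    obtain ⟨c, hc⟩ := ih
    obtain ⟨d, hd⟩ := pow_three_dvd_one_add_pow_sub t n
    refine ⟨c + d, ?_⟩
    rw [sum_range_succ, Nat.choose_succ_succ' n 1, Nat.choose_succ_succ' n 2, Nat.choose_one_right]
    push_cast
    linear_combination hc + hd

theorem sq_dvd_two_mul_sum_add_sub {q : R} {n : ℕ} {z : ℕ → R}
    (hz : ∀ j < n, z j * (1 - q ^ (j + 1)) = q ^ (j + 1)) :
    (q ^ (n + 1) - 1) ^ 2 ∣ 2 * ∑ j ∈ range n, z j + n -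
      (q ^ (n + 1) - 1) * (∑ j ∈ range n, z j ^ 2 + ∑ j ∈ range n, z j) := by
  have key : 2 * ∑ j ∈ range n, z j + n -
      (q ^ (n + 1) - 1) * (∑ j ∈ range n, z j ^ 2 + ∑ j ∈ range n, z j) =
      ∑ j ∈ range n,
        (z j + z (n - 1 - j) + 1 - (q ^ (n + 1) - 1) * (z j ^ 2 + z j)) := by
    rw [sum_sub_distrib, sum_add_distrib, sum_add_distrib, sum_range_reflect z n, ← mul_sum,
      sum_add_distrib]
    simp
    ring
  rw [key]
  refine dvd_sum fun j hj ↦ ?_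
  have hj := mem_range.1 hj
  have h1 := hz j hj
  have h2 := hz (n - 1 - j) (by omega)
  have h3 : q ^ (n + 1) = q ^ (j + 1) * q ^ (n - 1 - j + 1) := by
    rw [← pow_add]; congr 1; omega
  rw [h3]
  generalize q ^ (j + 1) = a at *
  generalize q ^ (n - 1 - j + 1) = b at *
  generalize z j = x at *
  generalize z (n - 1 - j) = w at *
  have h4 : x + w + 1 = -(a * b - 1) * (1 + x) * (1 + w) := by
    linear_combination (-w) * h1 - (1 + x) * a * h2
  refine ⟨(1 + x) ^ 2 * (1 + w), ?_⟩
  linear_combination (1 - (a * b - 1) * (1 + x)) * h4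

theorem two_mul_natCast_choose_two (n : ℕ) : 2 * (n.choose 2 : R) = n * (n - 1) := by
  induction n with
  | zero => simp
  | succ n ih =>
    rw [Nat.choose_succ_succ' n 1, Nat.choose_one_right]
    push_cast
    linear_combination ih

theorem six_mul_natCast_choose_three (n : ℕ) :
    6 * (n.choose 3 : R) = n * (n - 1) * (n - 2) := by
  induction n with
  | zero => simp
  | succ n ih =>
    rw [Nat.choose_succ_succ' n 2]
    push_cast
    linear_combination ih + 3 * two_mul_natCast_choose_two (R := R) n

theorem IsPrimitiveRoot.prod_one_sub_pow_mul_mul [IsDomain R] {ζ : R} {n : ℕ}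
    (hζ : IsPrimitiveRoot ζ (n + 1)) (x : R) :
    (∏ j ∈ range n, (1 - ζ ^ (j + 1) * x)) * (1 - x) = 1 - x ^ (n + 1) := by
  have h := congrArg (eval 1) (X_pow_sub_C_eq_prod hζ n.zero_lt_succ (rfl : x ^ (n + 1) = _))
  rw [prod_range_succ', eval_mul, eval_prod] at h
  simpa using h.symm

end CommRing

section Field

variable {K : Type*} [Field K] [CharZero K]

theorem IsPrimitiveRoot.two_mul_sum_eq_and_twelve_mul_sum_sq_eq {ζ : K} {n : ℕ}
    (hζ : IsPrimitiveRoot ζ (n + 1))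
    {z : ℕ → K} (hz : ∀ j < n, z j * (1 - ζ ^ (j + 1)) = ζ ^ (j + 1)) :
    2 * ∑ j ∈ range n, z j = -n ∧ 12 * ∑ j ∈ range n, z j ^ 2 = n * (4 - n) := by
  have hprod : (n + 1 : K[X]) * ∏ j ∈ range n, (1 + X * C (z j)) =
      ∑ i ∈ range (n + 1), (1 + -X) ^ i := by
    have h1 : ∏ j ∈ range n, (1 - C ζ ^ (j + 1) * (1 + -X)) =
        ∑ i ∈ range (n + 1), (1 + -X) ^ i := by
      refine mul_right_cancel₀ (X_ne_zero (R := K)) ?_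
      linear_combination (hζ.map_of_injective (C_injective (R := K))).prod_one_sub_pow_mul_mul
        (1 + -X) + geom_sum_mul (1 + -X : K[X]) (n + 1)
    have h := congrArg (C : K → K[X]) hζ.prod_one_sub_pow_eq_order
    simp only [map_prod, map_add, map_natCast, map_one, map_sub, map_pow] at h
    rw [← h1, ← h, ← prod_mul_distrib]
    refine prod_congr rfl fun j hj ↦ ?_
    have h := congrArg (C : K → K[X]) (hz j (mem_range.1 hj))
    simp only [map_mul, map_sub, map_pow, map_one] at h
    linear_combination X * h
  obtain ⟨a, ha⟩ :=
    pow_three_dvd_two_mul_prod_one_add_mul_sub (range n) (fun j ↦ C (z j)) (X : K[X])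
  obtain ⟨b, hb⟩ := pow_three_dvd_geom_sum_one_add_sub (-X : K[X]) (n + 1)
  simp only [← map_pow, ← map_sum] at ha
  set e := ∑ j ∈ range n, z j
  set s := ∑ j ∈ range n, z j ^ 2
  have hd : X ^ 3 ∣ C (2 * (n + 1) * e + 2 * (n + 1).choose 2) * X +
      C ((n + 1) * (e ^ 2 - s) - 2 * (n + 1).choose 3) * X ^ 2 := by
    refine ⟨-2 * b - (n + 1) * a, ?_⟩
    simp only [map_mul, map_add, map_sub, map_pow, map_natCast, map_one, map_ofNat] at ha ⊢
    push_cast at hb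
    linear_combination 2 * hb - (n + 1) * ha + 2 * hprod
  have hcoeff {A B : K} (h : X ^ 3 ∣ C A * X + C B * X ^ 2) : A = 0 ∧ B = 0 := by
    rw [X_pow_dvd_iff] at h
    have h1 := h 1 (by norm_num)
    have h2 := h 2 (by norm_num)
    simp [coeff_X_pow] at h1 h2
    exact ⟨h1, h2⟩
  obtain ⟨c1, c2⟩ := hcoeff hd
  have hn : (n + 1 : K) ≠ 0 := by exact_mod_cast n.succ_ne_zero
  have k2 := two_mul_natCast_choose_two (R := K) (n + 1)
  have k3 := six_mul_natCast_choose_three (R := K) (n + 1)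
  push_cast at k2 k3
  have he : 2 * e = -n := by
    apply mul_left_cancel₀ hn
    linear_combination c1 - k2
  refine ⟨he, ?_⟩
  apply mul_left_cancel₀ hn
  linear_combination (-12) * c2 + 3 * (n + 1) * (2 * e - n) * he - 4 * k3

end Field

/-- The congruence for `qBinom` evaluated at `q`, in a local `ℚ`-algebra where
`q ^ (n + 1) - 1` cubes to zero and generates the maximal ideal. -/
theorem twentyFour_mul_qBinom_eq {A K : Type*} [CommRing A] [Field K] [CharZero K] (φ : A →+* K)
    (q : A) (n m : ℕ) (hcube : (q ^ (n + 1) - 1) ^ 3 = 0)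
    (hφ : ∀ x, φ x = 0 → q ^ (n + 1) - 1 ∣ x) (hunit : ∀ x, φ x ≠ 0 → IsUnit x)
    (hq : IsPrimitiveRoot (φ q) (n + 1)) :
    24 * aeval q (qBinom (m * (n + 1) + (n + 1)) (n + 1)) =
      24 * ∑ i ∈ range (m + 1), (q ^ ((n + 1) ^ 2)) ^ i -
        2 * (m + 1).choose 2 * n * (n + 2) * (q ^ (n + 1) - 1) ^ 2 := by
  have hu (j : ℕ) (hj : j < n) : IsUnit (1 - q ^ (j + 1)) := by
    refine hunit _ ?_
    rw [map_sub, map_one, map_pow, sub_ne_zero]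
    exact (hq.pow_ne_one_of_pos_of_lt j.succ_ne_zero (by omega)).symm
  have hex (j : ℕ) : ∃ z, j < n → z * (1 - q ^ (j + 1)) = q ^ (j + 1) := by
    by_cases hj : j < n
    · obtain ⟨u, hu⟩ := (hu j hj).exists_left_inv
      exact ⟨q ^ (j + 1) * u, fun _ ↦ by rw [mul_assoc, hu, mul_one]⟩
    · exact ⟨0, fun h ↦ absurd h hj⟩
  choose z hz using hex
  have hqb : aeval q (qBinom (m * (n + 1) + (n + 1)) (n + 1)) =
      (∑ i ∈ range (m + 1), (q ^ (n + 1)) ^ i) *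
        ∏ j ∈ range n, (1 + (1 - (q ^ (n + 1)) ^ m) * z j) := by
    have h := congrArg (aeval q) (qBinom_mul_mul_prod m n)
    simp only [map_mul, map_prod, map_sum, map_sub, map_pow, map_one, aeval_X] at h
    have hD : IsUnit (∏ j ∈ range n, (1 - q ^ (j + 1))) :=
      IsUnit.prod_iff.2 fun j hj ↦ hu j (mem_range.1 hj)
    refine hD.mul_right_cancel ?_
    rw [h, mul_assoc, ← prod_mul_distrib]
    congr 1
    refine prod_congr rfl fun j hj ↦ ?_
    have e : q ^ (m * (n + 1) + j + 1) = (q ^ (n + 1)) ^ m * q ^ (j + 1) := by ring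
    rw [e]
    linear_combination (-(1 - (q ^ (n + 1)) ^ m)) * hz j (mem_range.1 hj)
  have hφz : ∀ j < n, φ (z j) * (1 - φ q ^ (j + 1)) = φ q ^ (j + 1) := fun j hj ↦ by
    simpa using congrArg φ (hz j hj)
  obtain ⟨k1, k2⟩ := hq.two_mul_sum_eq_and_twelve_mul_sum_sq_eq hφz
  obtain ⟨b, hb⟩ := sq_dvd_two_mul_sum_add_sub hz
  obtain ⟨c, hc⟩ := hφ (12 * ∑ j ∈ range n, z j ^ 2 - n * (4 - n)) (by simp [map_ofNat, k2])
  obtain ⟨d, hd⟩ := hφ (2 * ∑ j ∈ range n, z j + n) (by simp [map_ofNat, k1])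
  obtain ⟨f, hf⟩ :=
    pow_three_dvd_two_mul_prod_one_add_mul_sub (range n) z (1 - (q ^ (n + 1)) ^ m)
  set t := q ^ (n + 1) - 1 with ht
  have hqt : q ^ (n + 1) = 1 + t := by rw [ht]; ring
  obtain ⟨g1, hg1⟩ := pow_three_dvd_one_add_pow_sub t m
  obtain ⟨g2, hg2⟩ := pow_three_dvd_geom_sum_one_add_sub t (m + 1)
  obtain ⟨g3, hg3⟩ := pow_three_dvd_one_add_pow_sub t (n + 1)
  obtain ⟨g4, hg4⟩ := pow_three_dvd_geom_sum_one_add_sub ((1 + t) ^ (n + 1) - 1) (m + 1)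
  have hqq : q ^ ((n + 1) ^ 2) = 1 + ((1 + t) ^ (n + 1) - 1) := by
    rw [← hqt]; ring
  rw [hqb, hqq]
  rw [hqt] at hf ⊢
  rw [hcube, zero_mul, sub_eq_zero] at hg1 hg2 hg3
  rw [hg1] at hf ⊢
  rw [hg2]
  rw [hg3] at hg4 ⊢
  have c2 := two_mul_natCast_choose_two (R := A) m
  have cm2 := two_mul_natCast_choose_two (R := A) (m + 1)
  have cm3 := six_mul_natCast_choose_three (R := A) (m + 1)
  have cn2 := two_mul_natCast_choose_two (R := A) (n + 1)
  push_cast at hg4 cm2 cm3 cn2 ⊢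
  generalize ((m + 1).choose 2 : A) = M2 at *
  generalize ((m + 1).choose 3 : A) = M3 at *
  generalize ((n + 1).choose 2 : A) = N2 at *
  generalize (m.choose 2 : A) = m2 at *
  generalize (n : A) = N at *
  generalize (m : A) = M at *
  clear_value t
  generalize ∑ j ∈ range n, z j = e at *
  generalize ∑ j ∈ range n, z j ^ 2 = s at *
  generalize ∏ j ∈ range n, (1 + (1 - (1 + M * t + m2 * t ^ 2)) * z j) = P at *
  generalize ∑ i ∈ range (m + 1), (1 + (1 + (N + 1) * t + N2 * t ^ 2 - 1)) ^ i = Q at *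
  have hQ : Q = M + 1 + M2 * ((N + 1) * t + N2 * t ^ 2) + M3 * (N + 1) ^ 2 * t ^ 2 := by
    linear_combination hg4 + (((N + 1) + N2 * t) ^ 3 * g4 +
      M3 * (2 * (N + 1) * N2 + N2 ^ 2 * t)) * hcube
  have ht2e : 2 * t ^ 2 * e = -N * t ^ 2 := by
    linear_combination t ^ 2 * hd + d * hcube
  have ht2s : 12 * t ^ 2 * s = N * (4 - N) * t ^ 2 := by
    linear_combination t ^ 2 * hc + c * hcube
  have hte : 24 * t * e = -12 * N * t - N * (N + 2) * t ^ 2 := by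
    linear_combination 12 * t * hb + ht2s + 6 * ht2e + 12 * b * hcube
  have hP2 : 2 * P = 2 - 2 * (M * t + m2 * t ^ 2) * e + M ^ 2 * t ^ 2 * (e ^ 2 - s) := by
    linear_combination hf + (-(M + m2 * t) ^ 3 * f +
      (2 * M * m2 + m2 ^ 2 * t) * (e ^ 2 - s)) * hcube
  have hP : 24 * P = 24 + M * (12 * N * t + N * (N + 2) * t ^ 2) + 12 * N * m2 * t ^ 2 +
      4 * M ^ 2 * N * (N - 1) * t ^ 2 := by
    linear_combination 12 * hP2 - M * hte + (-12 * m2 + M ^ 2 * (6 * e - 3 * N)) * ht2e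
      - M ^ 2 * ht2s
  rw [hQ]
  have hmul : 24 * ((M + 1 + M2 * t + M3 * t ^ 2) * P) =
      (M + 1 + M2 * t + M3 * t ^ 2) * (24 * P) := by ring
  rw [hmul, hP]
  linear_combination (-12 * N * t + (6 * M * N - 6 * N * (N + 1) + N * (N + 2)) * t ^ 2) * cm2
    - 12 * M2 * t ^ 2 * cn2 + (4 - 4 * (N + 1) ^ 2) * t ^ 2 * cm3 + 6 * N * (M + 1) * t ^ 2 * c2
    + (12 * M * N * M3 + (M2 + M3 * t) *
      (M * N * (N + 2) + 12 * N * m2 + 4 * M ^ 2 * N * (N - 1))) * hcube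

theorem cyclotomic_pow_three_dvd_twentyFour_mul (n m : ℕ) (hp : (n + 1).Prime) :
    cyclotomic (n + 1) ℚ ^ 3 ∣
      24 * (qBinom (m * (n + 1) + (n + 1)) (n + 1)).map (Int.castRingHom ℚ) -
        (24 * ∑ i ∈ range (m + 1), ((X : ℚ[X]) ^ ((n + 1) ^ 2)) ^ i -
          2 * (m + 1).choose 2 * n * (n + 2) * ((X : ℚ[X]) ^ (n + 1) - 1) ^ 2) := by
  set Φ := cyclotomic (n + 1) ℚ with hΦ
  have hζ := Complex.isPrimitiveRoot_exp (n + 1) n.succ_ne_zero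
  set ζ := Complex.exp (2 * Real.pi * Complex.I / (n + 1 : ℕ))
  have hmin : Φ = minpoly ℚ ζ := cyclotomic_eq_minpoly_rat hζ n.succ_pos
  have hroot : (Φ ^ 3).eval₂ (algebraMap ℚ ℂ) ζ = 0 := by
    rw [eval₂_pow, ← aeval_def, hmin, minpoly.aeval, zero_pow three_ne_zero]
  let φ : AdjoinRoot (Φ ^ 3) →+* ℂ := AdjoinRoot.lift (algebraMap ℚ ℂ) ζ hroot
  have hφmk (f : ℚ[X]) : φ (AdjoinRoot.mk _ f) = aeval ζ f := AdjoinRoot.lift_mk hroot f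
  have hφq : φ (AdjoinRoot.root _) = ζ := AdjoinRoot.lift_root hroot
  have hunit (x : AdjoinRoot (Φ ^ 3)) (hx : φ x ≠ 0) : IsUnit x := by
    obtain ⟨f, rfl⟩ := AdjoinRoot.mk_surjective x
    rw [hφmk] at hx
    have hcop : IsCoprime (Φ ^ 3) f := by
      refine IsCoprime.pow_left ?_
      refine ((cyclotomic.irreducible_rat n.succ_pos).coprime_iff_not_dvd).2 fun h ↦ hx ?_
      rwa [← hΦ, hmin, minpoly.dvd_iff] at h
    obtain ⟨a, b, hab⟩ := hcop
    refine IsUnit.of_mul_eq_one_right (AdjoinRoot.mk _ b) ?_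
    have h := congrArg (AdjoinRoot.mk (Φ ^ 3)) hab
    simpa only [map_add, map_mul, AdjoinRoot.mk_self, mul_zero, zero_add, map_one] using h
  have hXp : Φ * (X - 1) = X ^ (n + 1) - 1 := by
    have := Fact.mk hp
    exact cyclotomic_prime_mul_X_sub_one ℚ (n + 1)
  have hqp : AdjoinRoot.root (Φ ^ 3) ^ (n + 1) - 1 =
      AdjoinRoot.mk _ Φ * (AdjoinRoot.root (Φ ^ 3) - 1) := by
    have h := congrArg (AdjoinRoot.mk (Φ ^ 3)) hXp
    simpa using h.symm
  have h := twentyFour_mul_qBinom_eq φ (AdjoinRoot.root (Φ ^ 3)) n m ?_ ?_ hunit (by rwa [hφq])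
  · rw [← AdjoinRoot.mk_eq_mk]
    simp only [map_sub, map_mul, map_sum, map_pow, map_natCast, map_add, map_one, map_ofNat,
      AdjoinRoot.mk_X]
    rw [← h, ← AdjoinRoot.aeval_eq, aeval_def, aeval_def, eval₂_map]
    exact congrArg (fun g : ℤ →+* _ ↦ 24 * eval₂ g _ _) (Subsingleton.elim _ _)
  · rw [hqp, mul_pow, ← map_pow, AdjoinRoot.mk_self, zero_mul]
  · intro x hx
    obtain ⟨f, rfl⟩ := AdjoinRoot.mk_surjective x
    rw [hφmk] at hx
    have hu : IsUnit (AdjoinRoot.root (Φ ^ 3) - 1) := by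
      refine hunit _ ?_
      rw [map_sub, hφq, map_one, sub_ne_zero]
      exact hζ.ne_one hp.one_lt
    rw [hqp, hu.mul_right_dvd]
    refine map_dvd (AdjoinRoot.mk (Φ ^ 3)) ?_
    rw [hmin]
    exact minpoly.dvd ℚ ζ hx

theorem twelve_dvd_sq_sub_one {p : ℕ} (hp : p.Prime) (hp5 : 5 ≤ p) :
    (12 : ℤ) ∣ (p : ℤ) ^ 2 - 1 := by
  have h2 : p % 2 ≠ 0 := fun h ↦ by
    have := (Nat.prime_dvd_prime_iff_eq Nat.prime_two hp).1 (Nat.dvd_of_mod_eq_zero h)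
    omega
  have h3 : p % 3 ≠ 0 := fun h ↦ by
    have := (Nat.prime_dvd_prime_iff_eq Nat.prime_three hp).1 (Nat.dvd_of_mod_eq_zero h)
    omega
  refine Int.dvd_of_emod_eq_zero ?_
  have hz : (p : ℤ) % 12 = 1 ∨ (p : ℤ) % 12 = 5 ∨ (p : ℤ) % 12 = 7 ∨ (p : ℤ) % 12 = 11 := by
    omega
  rcases hz with h | h | h | h <;> simp [pow_two, Int.sub_emod, Int.mul_emod, h]

theorem q_glaisher (p : ℕ) (hp : p.Prime) (hp5 : 5 ≤ p) (k : ℕ) (hk : 0 < k) :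
    (qInt p) ^ 3 ∣
      qBinom (k * p) p -
        ((qInt k).comp (X ^ (p ^ 2)) -
          C ((k.choose 2 : ℤ) * (((p : ℤ) ^ 2 - 1) / 12)) * (X ^ p - 1) ^ 2) := by
  obtain ⟨d, hd⟩ := twelve_dvd_sq_sub_one hp hp5
  obtain ⟨n, rfl⟩ := Nat.exists_eq_add_of_lt hp.pos
  obtain ⟨m, rfl⟩ := Nat.exists_eq_add_of_lt hk
  simp only [zero_add] at *
  have hΦ : qInt (n + 1) = cyclotomic (n + 1) ℤ := by
    have := Fact.mk hp
    rw [cyclotomic_prime, qInt]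
  have h := cyclotomic_pow_three_dvd_twentyFour_mul n m hp
  rw [hd, Int.mul_ediv_cancel_left _ (by norm_num), hΦ]
  rw [← map_dvd_map (Int.castRingHom ℚ) Int.cast_injective ((cyclotomic.monic _ ℤ).pow 3)]
  have hunit : IsUnit (24 : ℚ[X]) := by
    have : (24 : ℚ[X]) = C 24 := rfl
    rw [this, isUnit_C]
    exact isUnit_iff_ne_zero.2 (by norm_num)
  rw [← hunit.dvd_mul_left, Polynomial.map_pow, map_cyclotomic]
  convert h using 1
  have hd' := congrArg (Int.cast : ℤ → ℚ[X]) hd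
  push_cast at hd'
  rw [add_one_mul m (n + 1)]
  simp [qInt, Polynomial.map_sum, Polynomial.sum_comp]
  linear_combination (-2) * ((m + 1).choose 2 : ℚ[X]) * (X ^ (n + 1) - 1) ^ 2 * hd'
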